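/- Let ζ be an extremal number. Then w_{3,4}(ζ) ≥ 3, i.e. for every η < 3 and arbitrarily large X the system H(P) ≤ X, 0 < |P(ζ)| ≤ X^{−η} has at least 4 linearly independent solutions P ∈ ℤ[T] of degree at most 3. -/

import Mathlib

open Polynomial

/-- Height of an integer polynomial: the maximum absolute value of its coefficients. -/
noncomputable def polyH (P : Polynomial ℤ) : ℝ :=
  (((P.support.sup fun i => (P.coeff i).natAbs) : ℕ) : ℝ)

/-- Evaluation of an integer polynomial at a real number. -/
noncomputable def pev (ζ : ℝ) (P : Polynomial ℤ) : ℝ := Polynomial.aeval ζ P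

/-- Set of exponents η such that for arbitrarily large X the system
    H(P) ≤ X, 0 < |P(ζ)| ≤ X^(−η) has a solution of degree at most n. -/
def wSet (n : ℕ) (ζ : ℝ) : Set ℝ :=
  {η | ∀ X₀ : ℝ, ∃ X : ℝ, X₀ ≤ X ∧ ∃ P : Polynomial ℤ,
    P.natDegree ≤ n ∧ polyH P ≤ X ∧ 0 < |pev ζ P| ∧ |pev ζ P| ≤ X ^ (-η)}

/-- The exponent w_n(ζ). -/
noncomputable def wExp (n : ℕ) (ζ : ℝ) : ℝ := sSup (wSet n ζ)

/-- Set of exponents η such that for all sufficiently large X the system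
    H(P) ≤ X, 0 < |P(ζ)| ≤ X^(−η) has a solution of degree at most n. -/
def whSet (n : ℕ) (ζ : ℝ) : Set ℝ :=
  {η | ∃ X₀ : ℝ, ∀ X : ℝ, X₀ ≤ X → ∃ P : Polynomial ℤ,
    P.natDegree ≤ n ∧ polyH P ≤ X ∧ 0 < |pev ζ P| ∧ |pev ζ P| ≤ X ^ (-η)}

/-- The uniform exponent ŵ_n(ζ). -/
noncomputable def whExp (n : ℕ) (ζ : ℝ) : ℝ := sSup (whSet n ζ)

/-- Set of exponents η such that for arbitrarily large X the system
    |x| ≤ X, max_{1≤i≤n} |ζ^i x − y_i| ≤ X^(−η) has a nonzero integer solution. -/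
def lamSet (n : ℕ) (ζ : ℝ) : Set ℝ :=
  {η | ∀ X₀ : ℝ, ∃ X : ℝ, X₀ ≤ X ∧ ∃ x : ℤ, ∃ y : Fin n → ℤ,
    (x ≠ 0 ∨ y ≠ 0) ∧ ((|x| : ℤ) : ℝ) ≤ X ∧
    ∀ i : Fin n, |ζ ^ ((i : ℕ) + 1) * (x : ℝ) - (y i : ℝ)| ≤ X ^ (-η)}

/-- The exponent λ_n(ζ). -/
noncomputable def lamExp (n : ℕ) (ζ : ℝ) : ℝ := sSup (lamSet n ζ)

/-- Set of exponents η such that for all sufficiently large X the system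
    |x| ≤ X, max_{1≤i≤n} |ζ^i x − y_i| ≤ X^(−η) has a nonzero integer solution. -/
def lamhSet (n : ℕ) (ζ : ℝ) : Set ℝ :=
  {η | ∃ X₀ : ℝ, ∀ X : ℝ, X₀ ≤ X → ∃ x : ℤ, ∃ y : Fin n → ℤ,
    (x ≠ 0 ∨ y ≠ 0) ∧ ((|x| : ℤ) : ℝ) ≤ X ∧
    ∀ i : Fin n, |ζ ^ ((i : ℕ) + 1) * (x : ℝ) - (y i : ℝ)| ≤ X ^ (-η)}

/-- The uniform exponent λ̂_n(ζ). -/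
noncomputable def lamhExp (n : ℕ) (ζ : ℝ) : ℝ := sSup (lamhSet n ζ)

/-- Set of exponents η such that for arbitrarily large X the polynomial system has
    at least j linearly independent solutions of degree at most n. -/
def wSetJ (n j : ℕ) (ζ : ℝ) : Set ℝ :=
  {η | ∀ X₀ : ℝ, ∃ X : ℝ, X₀ ≤ X ∧ ∃ P : Fin j → Polynomial ℤ,
    LinearIndependent ℤ P ∧ ∀ i : Fin j,
      (P i).natDegree ≤ n ∧ polyH (P i) ≤ X ∧ 0 < |pev ζ (P i)| ∧ |pev ζ (P i)| ≤ X ^ (-η)}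

/-- The exponent w_{n,j}(ζ). -/
noncomputable def wExpJ (n j : ℕ) (ζ : ℝ) : ℝ := sSup (wSetJ n j ζ)

/-- Set of exponents η such that for all sufficiently large X the polynomial system has
    at least j linearly independent solutions of degree at most n. -/
def whSetJ (n j : ℕ) (ζ : ℝ) : Set ℝ :=
  {η | ∃ X₀ : ℝ, ∀ X : ℝ, X₀ ≤ X → ∃ P : Fin j → Polynomial ℤ,
    LinearIndependent ℤ P ∧ ∀ i : Fin j,
      (P i).natDegree ≤ n ∧ polyH (P i) ≤ X ∧ 0 < |pev ζ (P i)| ∧ |pev ζ (P i)| ≤ X ^ (-η)}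

/-- The uniform exponent ŵ_{n,j}(ζ). -/
noncomputable def whExpJ (n j : ℕ) (ζ : ℝ) : ℝ := sSup (whSetJ n j ζ)

/-- Set of exponents η such that for arbitrarily large X the simultaneous approximation
    system has at least j linearly independent integer vector solutions. -/
def lamSetJ (n j : ℕ) (ζ : ℝ) : Set ℝ :=
  {η | ∀ X₀ : ℝ, ∃ X : ℝ, X₀ ≤ X ∧ ∃ v : Fin j → (Fin (n + 1) → ℤ),
    LinearIndependent ℤ v ∧ ∀ i : Fin j,
      ((|v i 0| : ℤ) : ℝ) ≤ X ∧
      ∀ t : Fin n, |ζ ^ ((t : ℕ) + 1) * ((v i 0 : ℤ) : ℝ) - ((v i t.succ : ℤ) : ℝ)| ≤ X ^ (-η)}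

/-- The exponent λ_{n,j}(ζ). -/
noncomputable def lamExpJ (n j : ℕ) (ζ : ℝ) : ℝ := sSup (lamSetJ n j ζ)

/-- Set of exponents η such that for all sufficiently large X the simultaneous approximation
    system has at least j linearly independent integer vector solutions. -/
def lamhSetJ (n j : ℕ) (ζ : ℝ) : Set ℝ :=
  {η | ∃ X₀ : ℝ, ∀ X : ℝ, X₀ ≤ X → ∃ v : Fin j → (Fin (n + 1) → ℤ),
    LinearIndependent ℤ v ∧ ∀ i : Fin j,
      ((|v i 0| : ℤ) : ℝ) ≤ X ∧
      ∀ t : Fin n, |ζ ^ ((t : ℕ) + 1) * ((v i 0 : ℤ) : ℝ) - ((v i t.succ : ℤ) : ℝ)| ≤ X ^ (-η)}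

/-- The uniform exponent λ̂_{n,j}(ζ). -/
noncomputable def lamhExpJ (n j : ℕ) (ζ : ℝ) : ℝ := sSup (lamhSetJ n j ζ)

/-- An extremal number: a real transcendental number with ŵ₂(ζ) = (3+√5)/2. -/
def IsExtremal (ζ : ℝ) : Prop :=
  Transcendental ℚ ζ ∧ whExp 2 ζ = (3 + Real.sqrt 5) / 2


/-- Value at `ζ` of the quadratic polynomial `v 0 + v 1 T + v 2 T ^ 2`. -/
def quadEval (ζ : ℝ) (v : Fin 3 → ℤ) : ℝ := v 0 + v 1 * ζ + v 2 * ζ ^ 2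

/-- Derivative at `ζ` of the quadratic polynomial `v 0 + v 1 T + v 2 T ^ 2`. -/
def quadDeriv (ζ : ℝ) (v : Fin 3 → ℤ) : ℝ := v 1 + 2 * v 2 * ζ

/-- Maximum of the absolute values of the entries of `v`. -/
def quadHeight (v : Fin 3 → ℤ) : ℕ := Finset.univ.sup fun i => (v i).natAbs

lemma abs_le_quadHeight (v : Fin 3 → ℤ) (i : Fin 3) : |(v i : ℝ)| ≤ quadHeight v := by
  have h : (v i).natAbs ≤ quadHeight v :=
    Finset.le_sup (f := fun i => (v i).natAbs) (Finset.mem_univ i)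
  rw [← Int.cast_abs, Int.abs_eq_natAbs]
  exact_mod_cast h

lemma quadHeight_le_iff {v : Fin 3 → ℤ} {n : ℕ} :
    quadHeight v ≤ n ↔ ∀ i, (v i).natAbs ≤ n := by
  simp [quadHeight]

lemma one_le_quadHeight {v : Fin 3 → ℤ} (hv : v ≠ 0) : 1 ≤ quadHeight v := by
  by_contra! h
  refine hv (funext fun i => ?_)
  have := quadHeight_le_iff.1 (Nat.lt_one_iff.1 h).le i
  simpa using this

lemma finite_quadHeight_le (n : ℕ) : {v : Fin 3 → ℤ | quadHeight v ≤ n}.Finite := by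
  refine (Set.finite_Icc (fun _ => -(n : ℤ)) (fun _ => (n : ℤ))).subset fun v hv => ?_
  have h := quadHeight_le_iff.1 hv
  exact ⟨fun i => by have := h i; dsimp only; omega, fun i => by have := h i; dsimp only; omega⟩

/-- A bound for the evaluation and the derivative at `ζ` in terms of the height. -/
def evalConst (ζ : ℝ) : ℝ := 1 + 2 * |ζ| + ζ ^ 2

lemma one_le_evalConst (ζ : ℝ) : 1 ≤ evalConst ζ := by
  unfold evalConst; nlinarith [abs_nonneg ζ, sq_nonneg ζ]

lemma abs_quadEval_le (ζ : ℝ) (v : Fin 3 → ℤ) :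
    |quadEval ζ v| ≤ evalConst ζ * quadHeight v := by
  have h0 := abs_le_quadHeight v 0
  have h1 := mul_le_mul_of_nonneg_right (abs_le_quadHeight v 1) (abs_nonneg ζ)
  have h2 := mul_le_mul_of_nonneg_right (abs_le_quadHeight v 2) (sq_nonneg ζ)
  have h3 : 0 ≤ (quadHeight v : ℝ) * |ζ| := by positivity
  calc |quadEval ζ v| ≤ |(v 0 : ℝ)| + |v 1 * ζ| + |v 2 * ζ ^ 2| := abs_add_three _ _ _
    _ = |(v 0 : ℝ)| + |(v 1 : ℝ)| * |ζ| + |(v 2 : ℝ)| * ζ ^ 2 := by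
      rw [abs_mul, abs_mul, abs_of_nonneg (sq_nonneg ζ)]
    _ ≤ _ := by unfold evalConst; linarith

lemma abs_quadDeriv_le (ζ : ℝ) (v : Fin 3 → ℤ) :
    |quadDeriv ζ v| ≤ evalConst ζ * quadHeight v := by
  have h1 := abs_le_quadHeight v 1
  have h2 := mul_le_mul_of_nonneg_right (abs_le_quadHeight v 2) (abs_nonneg ζ)
  have h3 : 0 ≤ (quadHeight v : ℝ) * ζ ^ 2 := by positivity
  calc |quadDeriv ζ v| ≤ |(v 1 : ℝ)| + |2 * v 2 * ζ| := abs_add_le _ _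
    _ = |(v 1 : ℝ)| + 2 * |(v 2 : ℝ)| * |ζ| := by rw [abs_mul, abs_mul, abs_two]
    _ ≤ _ := by unfold evalConst; linarith

/-- The sequence of minimal points attached to `ζ`: successive records of small values of
quadratic integer polynomials at `ζ`. -/
structure IsMinimalSeq (ζ : ℝ) (Q : ℕ → Fin 3 → ℤ) : Prop where
  ne_zero : ∀ n, Q n ≠ 0
  height_strictMono : StrictMono fun n => quadHeight (Q n)
  eval_strictAnti : StrictAnti fun n => |quadEval ζ (Q n)|
  height_le : ∀ n v, v ≠ 0 → |quadEval ζ v| < |quadEval ζ (Q n)| →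
    quadHeight (Q (n + 1)) ≤ quadHeight v

lemma exists_next_minimal {ζ : ℝ}
    (h : ∀ ε > 0, ∃ v : Fin 3 → ℤ, v ≠ 0 ∧ |quadEval ζ v| < ε) {ε : ℝ} (hε : 0 < ε) :
    ∃ w : Fin 3 → ℤ, w ≠ 0 ∧ |quadEval ζ w| < ε ∧
      (∀ v : Fin 3 → ℤ, v ≠ 0 → |quadEval ζ v| < ε → quadHeight w ≤ quadHeight v) ∧
      ∀ v : Fin 3 → ℤ, v ≠ 0 → |quadEval ζ v| < |quadEval ζ w| → quadHeight w < quadHeight v := by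
  classical
  have hex : ∃ n : ℕ, ∃ v : Fin 3 → ℤ, v ≠ 0 ∧ |quadEval ζ v| < ε ∧ quadHeight v = n := by
    obtain ⟨v, hv, hv'⟩ := h ε hε
    exact ⟨_, v, hv, hv', rfl⟩
  set N := Nat.find hex
  have hmin : ∀ v : Fin 3 → ℤ, v ≠ 0 → |quadEval ζ v| < ε → N ≤ quadHeight v :=
    fun v hv hv' => Nat.find_min' hex ⟨v, hv, hv', rfl⟩
  let S : Set (Fin 3 → ℤ) := {v | v ≠ 0 ∧ |quadEval ζ v| < ε ∧ quadHeight v = N}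
  have hS : S.Finite := (finite_quadHeight_le N).subset fun v hv => hv.2.2.le
  obtain ⟨w, ⟨hw0, hwε, hwN⟩, hw⟩ :=
    S.exists_min_image (fun v => |quadEval ζ v|) hS (Nat.find_spec hex)
  refine ⟨w, hw0, hwε, fun v hv hv' => hwN ▸ hmin v hv hv', fun v hv hv' => ?_⟩
  refine lt_of_le_of_ne (hwN ▸ hmin v hv (hv'.trans hwε)) fun heq => ?_
  exact absurd (hw v ⟨hv, hv'.trans hwε, heq ▸ hwN⟩) (not_le.2 hv')

lemma exists_isMinimalSeq {ζ : ℝ} (hζ : ∀ v : Fin 3 → ℤ, v ≠ 0 → quadEval ζ v ≠ 0)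
    (h : ∀ ε > 0, ∃ v : Fin 3 → ℤ, v ≠ 0 ∧ |quadEval ζ v| < ε) :
    ∃ Q, IsMinimalSeq ζ Q := by
  choose f hf0 hfε hfle hflt using
    fun v : {v : Fin 3 → ℤ // v ≠ 0} => exists_next_minimal h (abs_pos.2 (hζ v.1 v.2))
  let g : {v : Fin 3 → ℤ // v ≠ 0} → {v : Fin 3 → ℤ // v ≠ 0} := fun v => ⟨f v, hf0 v⟩
  let s : {v : Fin 3 → ℤ // v ≠ 0} := ⟨1, one_ne_zero⟩
  have hs : ∀ n, (g^[n + 1] s).1 = f (g^[n] s) := fun n => by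
    rw [Function.iterate_succ_apply']
  refine ⟨fun n => (g^[n + 1] s).1, fun n => (g^[n + 1] s).2, strictMono_nat_of_lt_succ fun n => ?_,
    strictAnti_nat_of_succ_lt fun n => ?_, fun n v hv hv' => ?_⟩
  · have h1 := hfε (g^[n + 1] s)
    rw [← hs (n + 1)] at h1
    have h2 := hflt (g^[n] s) (g^[n + 2] s).1 (g^[n + 2] s).2
    rw [← hs n] at h2
    exact h2 h1
  · have h1 := hfε (g^[n + 1] s)
    rwa [← hs (n + 1)] at h1
  · have h1 := hfle (g^[n + 1] s) v hv hv'
    rwa [← hs (n + 1)] at h1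

/-- The resultant form: `disc (crossProduct p q)` is, up to sign, the resultant of the quadratic
polynomials attached to `p` and `q`. -/
def disc (x : Fin 3 → ℤ) : ℤ := x 0 * x 2 - x 1 ^ 2

/-- The first error `x 1 - ζ x 0`. -/
def errOne (ζ : ℝ) (x : Fin 3 → ℤ) : ℝ := x 1 - ζ * x 0

/-- The second, centred, error `x 2 - 2 ζ x 1 + ζ ^ 2 x 0`. -/
def errTwo (ζ : ℝ) (x : Fin 3 → ℤ) : ℝ := x 2 - 2 * ζ * x 1 + ζ ^ 2 * x 0

lemma disc_eq (ζ : ℝ) (x : Fin 3 → ℤ) :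
    (disc x : ℝ) = x 0 * errTwo ζ x - errOne ζ x ^ 2 := by
  simp only [disc, errOne, errTwo]; push_cast; ring

lemma errOne_cross (ζ : ℝ) (p q : Fin 3 → ℤ) :
    errOne ζ (crossProduct p q) = p 2 * quadEval ζ q - q 2 * quadEval ζ p := by
  simp [errOne, cross_apply, quadEval]; ring

lemma errTwo_cross (ζ : ℝ) (p q : Fin 3 → ℤ) :
    errTwo ζ (crossProduct p q) = quadEval ζ p * quadDeriv ζ q - quadDeriv ζ p * quadEval ζ q := by
  simp [errTwo, cross_apply, quadEval, quadDeriv]; ring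

lemma abs_mul_sub_mul_le {a b c d A B C D : ℝ} (ha : |a| ≤ A) (hb : |b| ≤ B) (hc : |c| ≤ C)
    (hd : |d| ≤ D) : |a * b - c * d| ≤ A * B + C * D := by
  calc |a * b - c * d| ≤ |a * b| + |c * d| := abs_sub _ _
    _ = |a| * |b| + |c| * |d| := by rw [abs_mul, abs_mul]
    _ ≤ _ := by
      have := (abs_nonneg a).trans ha
      have := (abs_nonneg c).trans hc
      gcongr

lemma abs_cross_le (p q : Fin 3 → ℤ) (i : Fin 3) :
    |(crossProduct p q i : ℝ)| ≤ 2 * quadHeight p * quadHeight q := by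
  have hp := abs_le_quadHeight p
  have hq := abs_le_quadHeight q
  have key : ∀ j k, |(p j * q k - p k * q j : ℝ)| ≤ 2 * quadHeight p * quadHeight q := fun j k =>
    (abs_mul_sub_mul_le (hp j) (hq k) (hp k) (hq j)).trans_eq (by ring)
  fin_cases i <;> simp only [cross_apply]
  · simpa using key 1 2
  · simpa using key 2 0
  · simpa using key 0 1

section Bounds

variable {ζ : ℝ} {p q r : Fin 3 → ℤ}

lemma abs_errOne_cross_le (hH : quadHeight p ≤ quadHeight q)
    (hE : |quadEval ζ q| ≤ |quadEval ζ p|) :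
    |errOne ζ (crossProduct p q)| ≤ 2 * |quadEval ζ p| * quadHeight q := by
  rw [errOne_cross]
  have hH' : (quadHeight p : ℝ) ≤ quadHeight q := by exact_mod_cast hH
  exact (abs_mul_sub_mul_le ((abs_le_quadHeight p 2).trans hH') hE
    (abs_le_quadHeight q 2) le_rfl).trans_eq (by ring)

lemma abs_errTwo_cross_le (hH : quadHeight p ≤ quadHeight q)
    (hE : |quadEval ζ q| ≤ |quadEval ζ p|) :
    |errTwo ζ (crossProduct p q)| ≤ 2 * evalConst ζ * |quadEval ζ p| * quadHeight q := by
  rw [errTwo_cross]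
  have hH' : evalConst ζ * quadHeight p ≤ evalConst ζ * quadHeight q :=
    mul_le_mul_of_nonneg_left (by exact_mod_cast hH) (zero_le_one.trans (one_le_evalConst ζ))
  exact (abs_mul_sub_mul_le le_rfl (abs_quadDeriv_le ζ q) ((abs_quadDeriv_le ζ p).trans hH')
    hE).trans_eq (by ring)

lemma one_le_abs_cast {n : ℤ} (hn : n ≠ 0) : (1 : ℝ) ≤ |(n : ℝ)| := by
  rw [← Int.cast_abs]
  exact_mod_cast Int.one_le_abs hn

lemma one_le_of_det_ne_zero (hpq : quadHeight p ≤ quadHeight q) (hqr : quadHeight q ≤ quadHeight r)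
    (hpq' : |quadEval ζ q| ≤ |quadEval ζ p|) (hqr' : |quadEval ζ r| ≤ |quadEval ζ q|)
    (h : p ⬝ᵥ crossProduct q r ≠ 0) :
    1 ≤ 6 * evalConst ζ * |quadEval ζ p| * quadHeight q * quadHeight r := by
  refine (one_le_abs_cast h).trans ?_
  have hK := one_le_evalConst ζ
  have e : ((p ⬝ᵥ crossProduct q r : ℤ) : ℝ) = quadEval ζ p * (crossProduct q r 0 : ℤ) +
      quadDeriv ζ p * errOne ζ (crossProduct q r) + p 2 * errTwo ζ (crossProduct q r) := by
    simp [Matrix.vec3_dotProduct, quadEval, quadDeriv, errOne, errTwo]; ring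
  have hH1 : (quadHeight p : ℝ) ≤ quadHeight q := by exact_mod_cast hpq
  have t1 := mul_le_mul (le_refl |quadEval ζ p|) (abs_cross_le q r 0) (abs_nonneg _) (abs_nonneg _)
  have t2 := mul_le_mul ((abs_quadDeriv_le ζ p).trans (mul_le_mul_of_nonneg_left hH1 (by linarith)))
    (abs_errOne_cross_le hqr hqr') (abs_nonneg _) (by positivity)
  have t3 := mul_le_mul ((abs_le_quadHeight p 2).trans hH1)
    (abs_errTwo_cross_le hqr hqr') (abs_nonneg _) (by positivity)
  rw [← abs_mul] at t1 t2 t3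
  rw [e]
  refine (abs_add_three _ _ _).trans ?_
  have s1 : |quadEval ζ p| * (2 * quadHeight q * quadHeight r) ≤
      evalConst ζ * (|quadEval ζ p| * (2 * quadHeight q * quadHeight r)) :=
    le_mul_of_one_le_left (by positivity) hK
  have s2 : evalConst ζ * (quadHeight q : ℝ) * (2 * |quadEval ζ q| * quadHeight r) ≤
      evalConst ζ * (quadHeight q : ℝ) * (2 * |quadEval ζ p| * quadHeight r) := by gcongr
  have s3 : (quadHeight q : ℝ) * (2 * evalConst ζ * |quadEval ζ q| * quadHeight r) ≤
      (quadHeight q : ℝ) * (2 * evalConst ζ * |quadEval ζ p| * quadHeight r) := by gcongr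
  linarith

lemma one_le_of_disc_ne_zero {p' q' : Fin 3 → ℤ}
    (hH : quadHeight p ≤ quadHeight q) (hE : |quadEval ζ q| ≤ |quadEval ζ p|)
    (hH' : quadHeight p' ≤ quadHeight q') (hE' : |quadEval ζ q'| ≤ |quadEval ζ p'|)
    {r : ℝ} (hr : r ≠ 0) (h : ∀ i, (crossProduct p' q' i : ℝ) = r * crossProduct p q i)
    (hd : disc (crossProduct p q) ≠ 0) :
    1 ≤ 8 * evalConst ζ * quadHeight p * quadHeight q * |quadEval ζ p'| * quadHeight q' := by
  set x := crossProduct p q with hx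
  set y := crossProduct p' q' with hy
  have hN : ((x 0 * y 2 - x 1 * y 1 : ℤ) : ℝ) = r * disc x := by
    push_cast [disc]; rw [h 1, h 2]; ring
  have hN' : ((x 0 * y 2 - x 1 * y 1 : ℤ) : ℝ) = x 0 * errTwo ζ y - errOne ζ x * errOne ζ y := by
    rw [hN, disc_eq ζ]; simp only [errOne, errTwo, h]; ring
  have hN0 : x 0 * y 2 - x 1 * y 1 ≠ 0 := by
    have : ((x 0 * y 2 - x 1 * y 1 : ℤ) : ℝ) ≠ 0 := by
      rw [hN]; exact mul_ne_zero hr (by exact_mod_cast hd)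
    exact_mod_cast this
  have h1 := one_le_abs_cast hN0
  rw [hN'] at h1
  have h2 := abs_mul_sub_mul_le (abs_cross_le p q 0) (abs_errTwo_cross_le hH' hE')
    (abs_errOne_cross_le hH hE) (abs_errOne_cross_le hH' hE')
  have h3 : 2 * |quadEval ζ p| * quadHeight q * (2 * |quadEval ζ p'| * quadHeight q') ≤
      2 * (evalConst ζ * quadHeight p) * quadHeight q * (2 * |quadEval ζ p'| * quadHeight q') := by
    gcongr; exact abs_quadEval_le ζ p
  linarith

lemma exists_int_factor {p : Fin 3 → ℤ} (hp : p ≠ 0) {d n : ℤ} (hd : d ≠ 0) (hco : IsCoprime d n)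
    (h : p 0 * d ^ 2 + p 1 * (n * d) + p 2 * n ^ 2 = 0) :
    ∃ a b : ℤ, p 0 = -(n * b) ∧ p 1 = d * b - n * a ∧ p 2 = d * a ∧ d.natAbs ≤ quadHeight p := by
  have h2 : d ∣ p 2 := by
    refine (hco.pow_right (n := 2)).dvd_of_dvd_mul_right ⟨-(p 0 * d + p 1 * n), ?_⟩
    linear_combination h
  obtain ⟨a, ha⟩ := h2
  have h3 : p 0 * d + n * (p 1 + n * a) = 0 := by
    refine (mul_eq_zero.1 (?_ : d * _ = 0)).resolve_left hd
    rw [ha] at h; linear_combination h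
  have h4 : d ∣ p 1 + n * a := by
    refine hco.dvd_of_dvd_mul_left ⟨-p 0, ?_⟩
    linear_combination h3
  obtain ⟨b, hb⟩ := h4
  have h5 : p 0 = -(n * b) := by
    have : d * (p 0 + n * b) = 0 := by rw [hb] at h3; linear_combination h3
    linarith [(mul_eq_zero.1 this).resolve_left hd]
  refine ⟨a, b, h5, by linarith, ha, ?_⟩
  by_cases ha0 : a = 0
  · have hb0 : b ≠ 0 := by
      rintro rfl
      refine hp (funext fun i => ?_)
      fin_cases i
      · simpa using h5
      · simpa [ha0] using hb
      · simpa [ha0] using ha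
    have : d.natAbs ≤ (p 1).natAbs :=
      Nat.le_of_dvd (Int.natAbs_pos.2 (by rw [ha0] at hb; simp at hb; rw [hb]; positivity))
        (Int.natAbs_dvd_natAbs.2 ⟨b, by rw [ha0] at hb; simpa using hb⟩)
    exact this.trans (quadHeight_le_iff.1 le_rfl 1)
  · have : d.natAbs ≤ (p 2).natAbs :=
      Nat.le_of_dvd (Int.natAbs_pos.2 (by rw [ha]; positivity)) (Int.natAbs_dvd_natAbs.2 ⟨a, ha⟩)
    exact this.trans (quadHeight_le_iff.1 le_rfl 2)

end Bounds

section Coprimality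

variable {ζ : ℝ} {p q r : Fin 3 → ℤ}

lemma root_identity {x : Fin 3 → ℤ} (hx : disc x = 0) {d n : ℤ} (h : x 0 * n = x 1 * d)
    (v : Fin 3 → ℤ) :
    x 0 ^ 2 * (v 0 * d ^ 2 + v 1 * (n * d) + v 2 * n ^ 2) = d ^ 2 * (x 0 * (v ⬝ᵥ x)) := by
  simp only [disc] at hx
  simp only [Matrix.vec3_dotProduct]
  linear_combination (v 1 * x 0 * d + v 2 * (x 0 * n + x 1 * d)) * h - v 2 * d ^ 2 * hx

lemma abs_mul_linear_le {d n a b c e : ℤ} (hp0 : p 0 = -(n * b)) (hp1 : p 1 = d * b - n * a)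
    (hp2 : p 2 = d * a) (hq0 : q 0 = -(n * e)) (hq1 : q 1 = d * e - n * c) (hq2 : q 2 = d * c)
    (hx : crossProduct p q 0 ≠ 0) (hH : quadHeight p ≤ quadHeight q)
    (hE : |quadEval ζ q| ≤ |quadEval ζ p|) :
    |(d * (d * ζ - n) : ℝ)| ≤ 2 * |quadEval ζ p| * quadHeight q := by
  have hH' : (quadHeight p : ℝ) ≤ quadHeight q := by exact_mod_cast hH
  have hm : c * b - a * e ≠ 0 := by
    intro h0
    refine hx ?_
    simp only [cross_apply, Matrix.cons_val_zero, hp1, hp2, hq1, hq2]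
    linear_combination d ^ 2 * h0
  have hkey : (q 2 : ℝ) * quadEval ζ p - p 2 * quadEval ζ q =
      d * (d * ζ - n) * ((c * b - a * e : ℤ) : ℝ) := by
    simp only [quadEval, hp0, hp1, hp2, hq0, hq1, hq2]; push_cast; ring
  have h1 := abs_mul_sub_mul_le (abs_le_quadHeight q 2) (le_refl |quadEval ζ p|)
    ((abs_le_quadHeight p 2).trans hH') hE
  rw [hkey, abs_mul] at h1
  have h2 := le_mul_of_one_le_right (abs_nonneg (d * (d * ζ - n) : ℝ)) (one_le_abs_cast hm)
  linarith

lemma one_le_of_disc_eq_zero (hp : p ≠ 0) (hq : q ≠ 0) (hr : quadHeight r ≤ quadHeight p)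
    (hH : quadHeight p ≤ quadHeight q) (hE : |quadEval ζ q| ≤ |quadEval ζ p|)
    (hdet : r ⬝ᵥ crossProduct p q ≠ 0) (hd : disc (crossProduct p q) = 0) :
    1 ≤ 4 * evalConst ζ * (quadHeight p ^ 2 * |quadEval ζ r| +
      quadHeight p * |quadEval ζ p| * quadHeight q) := by
  have hK := one_le_evalConst ζ
  have hHp : (1 : ℝ) ≤ quadHeight p := by exact_mod_cast one_le_quadHeight hp
  set E := |quadEval ζ p| * quadHeight q with hEdef
  have hE0 : 0 ≤ E := by positivity
  have hEle : E ≤ quadHeight p * E := le_mul_of_one_le_left hE0 hHp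
  have hKE : (quadHeight p : ℝ) * E ≤ evalConst ζ * (quadHeight p * E) :=
    le_mul_of_one_le_left (by positivity) hK
  have hL0 : 0 ≤ (quadHeight p : ℝ) ^ 2 * |quadEval ζ r| := by positivity
  have hKL : (quadHeight p : ℝ) ^ 2 * |quadEval ζ r| ≤
      evalConst ζ * (quadHeight p ^ 2 * |quadEval ζ r|) := le_mul_of_one_le_left hL0 hK
  rw [mul_assoc (quadHeight p : ℝ), ← hEdef]
  set x := crossProduct p q with hx
  have hx12 : x 0 * x 2 = x 1 ^ 2 := by simp only [disc] at hd; linarith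
  by_cases hx0 : x 0 = 0
  · have hx1 : x 1 = 0 := by
      rw [hx0, zero_mul] at hx12
      exact pow_eq_zero_iff two_ne_zero |>.1 hx12.symm
    have hx2 : x 2 ≠ 0 := fun hx2 => hdet (by simp [Matrix.vec3_dotProduct, hx0, hx1, hx2])
    have h1 := one_le_abs_cast hx2
    have h2 := abs_errTwo_cross_le hH hE
    rw [← hx, show errTwo ζ x = x 2 by simp [errTwo, hx0, hx1]] at h2
    have h3 : evalConst ζ * E ≤ evalConst ζ * (quadHeight p * E) := by gcongr
    nlinarith
  obtain ⟨d, n, hd0, hco, hdn⟩ : ∃ d n : ℤ, d ≠ 0 ∧ IsCoprime d n ∧ x 0 * n = x 1 * d := by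
    obtain ⟨d, n, hco, h0, h1⟩ := Int.exists_gcd_one (Int.gcd_pos_of_ne_zero_left (x 1) hx0)
    refine ⟨d, n, ?_, Int.isCoprime_iff_gcd_eq_one.2 hco, ?_⟩
    · rintro rfl
      exact hx0 (by rw [h0, zero_mul])
    · generalize (Int.gcd (x 0) (x 1) : ℤ) = g at h0 h1
      rw [h0, h1]; ring
  have hpx : p ⬝ᵥ x = 0 := by simp [hx]
  have hqx : q ⬝ᵥ x = 0 := by simp [hx]
  have hroot : ∀ v : Fin 3 → ℤ, v ⬝ᵥ x = 0 → v 0 * d ^ 2 + v 1 * (n * d) + v 2 * n ^ 2 = 0 := by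
    intro v hv
    have := root_identity hd hdn v
    rw [hv, mul_zero, mul_zero] at this
    exact (mul_eq_zero.1 this).resolve_left (pow_ne_zero 2 hx0)
  obtain ⟨a, b, hp0, hp1, hp2, hdp⟩ := exists_int_factor hp hd0 hco (hroot p hpx)
  obtain ⟨c, e, hq0, hq1, hq2, -⟩ := exists_int_factor hq hd0 hco (hroot q hqx)
  have hlin := abs_mul_linear_le hp0 hp1 hp2 hq0 hq1 hq2 hx0 hH hE
  rw [mul_assoc, ← hEdef] at hlin
  set l : ℝ := d * ζ - n with hl
  by_cases hbig : 1 ≤ 2 * E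
  · linarith
  have hl1 : |l| ≤ 2 * E := by
    rw [abs_mul] at hlin
    exact (le_mul_of_one_le_left (abs_nonneg _) (one_le_abs_cast hd0)).trans hlin
  have hl2 : |l ^ 2| ≤ 2 * E := by
    rw [abs_pow]; nlinarith [abs_nonneg l]
  have hN : r 0 * d ^ 2 + r 1 * (n * d) + r 2 * n ^ 2 ≠ 0 := by
    intro h0
    have := root_identity hd hdn r
    rw [h0, mul_zero] at this
    exact mul_ne_zero (pow_ne_zero 2 hd0) (mul_ne_zero hx0 hdet) this.symm
  have h1 := one_le_abs_cast hN
  have hNeq : ((r 0 * d ^ 2 + r 1 * (n * d) + r 2 * n ^ 2 : ℤ) : ℝ) =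
      d ^ 2 * quadEval ζ r + -(d * l * quadDeriv ζ r) + r 2 * l ^ 2 := by
    simp only [quadEval, quadDeriv, hl]; push_cast; ring
  have hdR : |(d : ℝ)| ≤ quadHeight p := by
    rw [← Int.cast_abs, Int.abs_eq_natAbs]; exact_mod_cast hdp
  have hrR : (quadHeight r : ℝ) ≤ quadHeight p := by exact_mod_cast hr
  have b1 : |(d : ℝ) ^ 2 * quadEval ζ r| ≤ quadHeight p ^ 2 * |quadEval ζ r| := by
    rw [abs_mul, abs_pow]; gcongr
  have b2 : |-(d * l * quadDeriv ζ r)| ≤ 2 * E * (evalConst ζ * quadHeight p) := by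
    rw [abs_neg, abs_mul]
    have := (abs_quadDeriv_le ζ r).trans (mul_le_mul_of_nonneg_left hrR (by linarith))
    gcongr
  have b3 : |(r 2 : ℝ) * l ^ 2| ≤ quadHeight p * (2 * E) := by
    rw [abs_mul]
    have := (abs_le_quadHeight r 2).trans hrR
    gcongr
  rw [hNeq] at h1
  have := abs_add_three ((d : ℝ) ^ 2 * quadEval ζ r) (-(d * l * quadDeriv ζ r)) (r 2 * l ^ 2)
  linarith

end Coprimality

/-- The integer polynomial `v 0 + v 1 T + v 2 T ^ 2 + v 3 T ^ 3`. -/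
noncomputable def cubicPoly (v : Fin 4 → ℤ) : Polynomial ℤ :=
  C (v 0) + C (v 1) * X + C (v 2) * X ^ 2 + C (v 3) * X ^ 3

lemma coeff_cubicPoly (v : Fin 4 → ℤ) (i : Fin 4) : (cubicPoly v).coeff i = v i := by
  fin_cases i <;> simp [cubicPoly, coeff_X, coeff_C, coeff_X_pow, -eq_intCast]

lemma natDegree_cubicPoly_le (v : Fin 4 → ℤ) : (cubicPoly v).natDegree ≤ 3 := by
  unfold cubicPoly; compute_degree

lemma pev_cubicPoly (ζ : ℝ) (v : Fin 4 → ℤ) :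
    pev ζ (cubicPoly v) = v 0 + v 1 * ζ + v 2 * ζ ^ 2 + v 3 * ζ ^ 3 := by
  simp [pev, cubicPoly]

lemma polyH_le {P : Polynomial ℤ} {B : ℝ} (hB : 0 ≤ B) (h : ∀ i, |(P.coeff i : ℝ)| ≤ B) :
    polyH P ≤ B := by
  rw [polyH, ← Nat.le_floor_iff hB]
  refine Finset.sup_le fun i _ => (Nat.le_floor_iff hB).2 ?_
  rw [Nat.cast_natAbs, Int.cast_abs]
  exact h i

lemma polyH_cubicPoly_le {v : Fin 4 → ℤ} {B : ℝ} (h : ∀ i, |(v i : ℝ)| ≤ B) :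
    polyH (cubicPoly v) ≤ B := by
  have hB : 0 ≤ B := (abs_nonneg _).trans (h 0)
  refine polyH_le hB fun i => ?_
  by_cases hi : i < 4
  · have := coeff_cubicPoly v ⟨i, hi⟩
    simp only at this
    rw [this]; exact h _
  · rw [coeff_eq_zero_of_natDegree_lt ((natDegree_cubicPoly_le v).trans_lt (by omega))]
    simpa using hB

lemma linearIndependent_cubicPoly {w : Fin 4 → Fin 4 → ℤ}
    (h : ∀ g : Fin 4 → ℤ, (∀ k, ∑ i, g i * w i k = 0) → g = 0) :
    LinearIndependent ℤ fun i => cubicPoly (w i) := by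
  refine Fintype.linearIndependent_iff.2 fun g hg i => ?_
  refine congrFun (h g fun k => ?_) i
  have := congrArg (fun P => Polynomial.coeff P (k : ℕ)) hg
  simpa [coeff_cubicPoly, finsetSum_coeff] using this

/-- Coefficients of the product of the quadratic polynomial `p` and of `b T - a`. -/
def mulLinear (p : Fin 3 → ℤ) (a b : ℤ) : Fin 4 → ℤ :=
  ![-(a * p 0), b * p 0 - a * p 1, b * p 1 - a * p 2, b * p 2]

lemma pev_mulLinear (ζ : ℝ) (p : Fin 3 → ℤ) (a b : ℤ) :
    pev ζ (cubicPoly (mulLinear p a b)) = quadEval ζ p * (b * ζ - a) := by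
  simp [pev_cubicPoly, mulLinear, quadEval]; ring

lemma abs_mulLinear_le {p : Fin 3 → ℤ} {a b : ℤ} {B : ℝ} (ha : |(a : ℝ)| ≤ B)
    (hb : |(b : ℝ)| ≤ B) (i : Fin 4) :
    |(mulLinear p a b i : ℝ)| ≤ 2 * B * quadHeight p := by
  have hp := abs_le_quadHeight p
  have hB : 0 ≤ B := (abs_nonneg _).trans ha
  have key : ∀ i j, |(b * p i - a * p j : ℝ)| ≤ 2 * B * quadHeight p := fun i j =>
    (abs_mul_sub_mul_le hb (hp i) ha (hp j)).trans_eq (by ring)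
  have hBp : 0 ≤ B * quadHeight p := by positivity
  fin_cases i
  · have := mul_le_mul ha (hp 0) (abs_nonneg _) hB
    simp [mulLinear, abs_mul]; linarith
  · simpa [mulLinear] using key 0 1
  · simpa [mulLinear] using key 1 2
  · have := mul_le_mul hb (hp 2) (abs_nonneg _) hB
    simp [mulLinear, abs_mul]; linarith

lemma sylvester_injective {p q : Fin 3 → ℤ} (h : disc (crossProduct p q) ≠ 0) {a b c d : ℤ}
    (h0 : a * p 0 + c * q 0 = 0) (h1 : a * p 1 + b * p 0 + c * q 1 + d * q 0 = 0)
    (h2 : a * p 2 + b * p 1 + c * q 2 + d * q 1 = 0) (h3 : b * p 2 + d * q 2 = 0) :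
    a = 0 ∧ b = 0 ∧ c = 0 ∧ d = 0 := by
  let M : Matrix (Fin 4) (Fin 4) ℤ :=
    !![p 0, 0, q 0, 0; p 1, p 0, q 1, q 0; p 2, p 1, q 2, q 1; 0, p 2, 0, q 2]
  have hM : M.det = -disc (crossProduct p q) := by
    simp [M, Matrix.det_succ_row_zero, Fin.sum_univ_succ, disc, cross_apply, Fin.succAbove]
    ring
  have hv : M.mulVec ![a, b, c, d] = 0 := by
    ext i
    fin_cases i <;> simp [M, Matrix.mulVec, dotProduct, Fin.sum_univ_four] <;> linarith
  have := Matrix.eq_zero_of_mulVec_eq_zero (hM ▸ neg_ne_zero.2 h) hv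
  exact ⟨congrFun this 0, congrFun this 1, congrFun this 2, congrFun this 3⟩

lemma linearIndependent_products {p q x : Fin 3 → ℤ} (h : disc (crossProduct p q) ≠ 0)
    (hx : disc x ≠ 0) :
    LinearIndependent ℤ fun i => cubicPoly (![mulLinear p (x 1) (x 0), mulLinear p (x 2) (x 1),
      mulLinear q (-1) 0, mulLinear q 0 1] i) := by
  refine linearIndependent_cubicPoly fun g hg => ?_
  have h0 := hg 0
  have h1 := hg 1
  have h2 := hg 2
  have h3 := hg 3
  simp only [Fin.sum_univ_four, mulLinear, Matrix.cons_val] at h0 h1 h2 h3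
  obtain ⟨ha, hb, hc, hd⟩ := sylvester_injective h (a := -(g 0 * x 1 + g 1 * x 2))
    (b := g 0 * x 0 + g 1 * x 1) (c := g 2) (d := g 3) (by linarith) (by linarith) (by linarith)
    (by linarith)
  have hg0 : disc x * g 0 = 0 := by
    simp only [disc]; linear_combination x 2 * hb + x 1 * ha
  have hg1 : disc x * g 1 = 0 := by
    simp only [disc]; linear_combination -x 1 * hb - x 0 * ha
  have e0 := (mul_eq_zero.1 hg0).resolve_left hx
  have e1 := (mul_eq_zero.1 hg1).resolve_left hx
  ext i
  fin_cases i <;> simp [*]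

lemma Transcendental.pev_ne_zero {ζ : ℝ} (hζ : Transcendental ℚ ζ) {P : Polynomial ℤ}
    (hP : P ≠ 0) : pev ζ P ≠ 0 := by
  have : Transcendental ℤ ζ := fun h => hζ (h.extendScalars (Int.cast_injective))
  exact fun h => hP (transcendental_iff.1 this P h)

lemma quadEval_eq_pev (ζ : ℝ) (v : Fin 3 → ℤ) :
    quadEval ζ v = pev ζ (cubicPoly ![v 0, v 1, v 2, 0]) := by
  simp [quadEval, pev_cubicPoly]

lemma Transcendental.quadEval_ne_zero {ζ : ℝ} (hζ : Transcendental ℚ ζ) {v : Fin 3 → ℤ}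
    (hv : v ≠ 0) : quadEval ζ v ≠ 0 := by
  rw [quadEval_eq_pev]
  refine hζ.pev_ne_zero fun h => hv ?_
  have key := fun i : Fin 4 =>
    (coeff_cubicPoly ![v 0, v 1, v 2, 0] i).symm.trans (by rw [h, coeff_zero])
  ext i
  fin_cases i
  · exact key 0
  · exact key 1
  · exact key 2

open Filter Topology Real

section Growth

variable {u v : ℕ → ℝ} {c : ℝ}

lemma tendsto_ratio_left (hu : Tendsto u atTop atTop)
    (h1 : ∀ τ < goldenRatio + 1, ∀ᶠ k in atTop, τ * u k ≤ c + u k + v k)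
    (h3 : ∀ τ < goldenRatio + 1, ∀ᶠ k in atTop, τ * v k ≤ c + u k + 2 * v k) :
    Tendsto (fun k => v k / u k) atTop (𝓝 goldenRatio) := by
  have hφ := goldenRatio_pos
  have hφ2 := goldenRatio_sq
  refine tendsto_order.2 ⟨fun a ha => ?_, fun b hb => ?_⟩
  · obtain ⟨τ, hτ1, hτ2⟩ := exists_between (add_lt_add_left ha 1)
    filter_upwards [h1 τ hτ2, hu.eventually_gt_atTop 0,
      hu.eventually_gt_atTop (c / (τ - 1 - a))] with k hk hk0 hkc
    rw [div_lt_iff₀ (by linarith)] at hkc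
    rw [lt_div_iff₀ hk0]
    linarith
  · have hb0 : 0 < b := hφ.trans hb
    have hbτ : 2 + 1 / b < goldenRatio + 1 := by
      have : 1 / b < goldenRatio - 1 := by rw [div_lt_iff₀ hb0]; nlinarith
      linarith
    obtain ⟨τ, hτ1, hτ2⟩ := exists_between hbτ
    have hbτ' : 1 < b * (τ - 2) := by
      have : 1 / b < τ - 2 := by linarith
      rwa [div_lt_iff₀' hb0] at this
    filter_upwards [h3 τ hτ2, hu.eventually_gt_atTop 0,
      hu.eventually_gt_atTop (c / (b * (τ - 2) - 1))] with k hk hk0 hkc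
    rw [div_lt_iff₀ (by linarith)] at hkc
    rw [div_lt_iff₀ hk0]
    have hτ : 0 < τ - 2 := by have : 0 < 1 / b := by positivity
                              linarith
    refine lt_of_mul_lt_mul_right (a := τ - 2) ?_ hτ.le
    nlinarith

lemma tendsto_ratio_succ (hu : Tendsto u atTop atTop) (hvu : ∀ k, v k ≤ u (k + 1))
    (h2 : ∀ τ < goldenRatio + 1, ∀ᶠ k in atTop, τ * u (k + 1) ≤ c + u k + v k + u (k + 1))
    (hv : Tendsto (fun k => v k / u k) atTop (𝓝 goldenRatio)) :
    Tendsto (fun k => u (k + 1) / u k) atTop (𝓝 goldenRatio) := by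
  have hφ := one_lt_goldenRatio
  have hφ2 := goldenRatio_sq
  refine tendsto_order.2 ⟨fun a ha => ?_, fun b hb => ?_⟩
  · filter_upwards [hv.eventually_const_lt ha, hu.eventually_gt_atTop 0] with k hk hk0
    exact hk.trans_le (by gcongr; exact hvu k)
  · set t := (b - goldenRatio) / (3 + (b - goldenRatio)) with ht
    have hs : 0 < b - goldenRatio := sub_pos.2 hb
    have ht0 : 0 < t := by positivity
    have ht1 : t * (3 + (b - goldenRatio)) = b - goldenRatio := by
      rw [ht, div_mul_cancel₀ _ (by positivity)]
    have hφlt := goldenRatio_lt_two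
    have hlt : 1 + (goldenRatio + t) < (goldenRatio - t) * b := by nlinarith
    filter_upwards [h2 (goldenRatio + 1 - t) (by linarith), hu.eventually_gt_atTop 0,
      hv.eventually_lt_const (lt_add_of_pos_right _ ht0),
      hu.eventually_gt_atTop (c / ((goldenRatio - t) * b - (1 + (goldenRatio + t))))]
      with k hk hk0 hkv hkc
    rw [div_lt_iff₀ (by linarith)] at hkc
    rw [div_lt_iff₀ hk0] at hkv ⊢
    have hτ : 0 < goldenRatio - t := by
      have : t < 1 := by rw [ht, div_lt_one (by positivity)]; linarith
      linarith
    refine lt_of_mul_lt_mul_right (a := goldenRatio - t) ?_ hτ.le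
    nlinarith

end Growth

section MinimalSeq

variable {ζ : ℝ} {Q : ℕ → Fin 3 → ℤ}

lemma exists_ratio {x y : Fin 3 → ℤ} (hx : x ≠ 0) (hy : y ≠ 0) (h : crossProduct x y = 0) :
    ∃ r : ℝ, r ≠ 0 ∧ ∀ i, (y i : ℝ) = r * x i := by
  have h0 : x 1 * y 2 - x 2 * y 1 = 0 := by simpa [cross_apply] using congrFun h 0
  have h1 : x 2 * y 0 - x 0 * y 2 = 0 := by simpa [cross_apply] using congrFun h 1
  have h2 : x 0 * y 1 - x 1 * y 0 = 0 := by simpa [cross_apply] using congrFun h 2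
  have hxy : ∀ i j, x i * y j = x j * y i := by
    intro i j
    fin_cases i <;> fin_cases j <;> simp only [Fin.zero_eta, Fin.mk_one, Fin.reduceFinMk] <;>
      linarith
  obtain ⟨i, hi⟩ := Function.ne_iff.1 hx
  have hi' : (x i : ℝ) ≠ 0 := by exact_mod_cast hi
  have hr : ∀ j, (y j : ℝ) = y i / x i * x j := by
    intro j
    field_simp
    have : (x i : ℝ) * y j = x j * y i := by exact_mod_cast hxy i j
    linarith
  refine ⟨y i / x i, fun h0 => hy (funext fun j => ?_), hr⟩
  have := hr j
  rw [h0, zero_mul] at this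
  exact_mod_cast this

lemma cross_cross_eq (p q r : Fin 3 → ℤ) :
    crossProduct (crossProduct p q) (crossProduct q r) = (p ⬝ᵥ crossProduct q r) • q := by
  rw [Matrix.vec3_dotProduct]
  ext i
  fin_cases i <;> simp [cross_apply] <;> ring

lemma exists_natAbs_eq_quadHeight (v : Fin 3 → ℤ) : ∃ i, |(v i : ℝ)| = quadHeight v := by
  obtain ⟨i, -, hi⟩ := Finset.exists_mem_eq_sup Finset.univ Finset.univ_nonempty
    (fun i => (v i).natAbs)
  refine ⟨i, ?_⟩
  rw [← Int.cast_abs, Int.abs_eq_natAbs, quadHeight, hi]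
  rfl

lemma IsMinimalSeq.cross_ne_zero (hQ : IsMinimalSeq ζ Q) {i j : ℕ} (hij : i < j) :
    crossProduct (Q i) (Q j) ≠ 0 := by
  intro h
  obtain ⟨r, -, hr⟩ := exists_ratio (hQ.ne_zero i) (hQ.ne_zero j) h
  obtain ⟨k, hk⟩ := exists_natAbs_eq_quadHeight (Q j)
  have h1 : (quadHeight (Q i) : ℝ) < quadHeight (Q j) := by
    exact_mod_cast hQ.height_strictMono hij
  have h2 : |quadEval ζ (Q j)| < |quadEval ζ (Q i)| := hQ.eval_strictAnti hij
  have h3 : quadEval ζ (Q j) = r * quadEval ζ (Q i) := by simp only [quadEval, hr]; ring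
  rw [h3, abs_mul] at h2
  have h4 : |r| < 1 := by
    by_contra! h4
    exact absurd h2 (not_lt.2 (le_mul_of_one_le_left (abs_nonneg _) h4))
  rw [hr, abs_mul] at hk
  have h5 := mul_le_mul h4.le (abs_le_quadHeight (Q i) k) (abs_nonneg _) zero_le_one
  linarith

/-- The determinant of three consecutive minimal points. -/
def consecDet (Q : ℕ → Fin 3 → ℤ) (k : ℕ) : ℤ :=
  Q k ⬝ᵥ crossProduct (Q (k + 1)) (Q (k + 2))

lemma IsMinimalSeq.exists_ratio_cross (hQ : IsMinimalSeq ζ Q) {i m : ℕ} (him : i ≤ m)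
    (h : ∀ k, i ≤ k → k < m → consecDet Q k = 0) :
    ∃ r : ℝ, r ≠ 0 ∧ ∀ t, (crossProduct (Q m) (Q (m + 1)) t : ℝ) =
      r * crossProduct (Q i) (Q (i + 1)) t := by
  induction m, him using Nat.le_induction with
  | base => exact ⟨1, one_ne_zero, fun t => (one_mul _).symm⟩
  | succ m him ih =>
    obtain ⟨r, hr0, hr⟩ := ih fun k hk hk' => h k hk (hk'.trans m.lt_succ_self)
    obtain ⟨s, hs0, hs⟩ := exists_ratio (hQ.cross_ne_zero m.lt_succ_self)
      (hQ.cross_ne_zero (m + 1).lt_succ_self)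
      (by rw [cross_cross_eq]; exact (congrArg (· • Q (m + 1)) (h m him m.lt_succ_self)).trans
            (zero_smul _ _))
    exact ⟨s * r, mul_ne_zero hs0 hr0, fun t => by rw [hs t, hr t, mul_assoc]⟩

lemma disc_ne_zero_of_ratio {x y : Fin 3 → ℤ} {r : ℝ} (hr : r ≠ 0)
    (h : ∀ i, (y i : ℝ) = r * x i) (hx : disc x ≠ 0) : disc y ≠ 0 := by
  have : (disc y : ℝ) = r ^ 2 * disc x := by simp only [disc]; push_cast; rw [h, h, h]; ring
  have h' : (disc y : ℝ) ≠ 0 := by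
    rw [this]; exact mul_ne_zero (pow_ne_zero 2 hr) (by exact_mod_cast hx)
  exact_mod_cast h'

lemma IsMinimalSeq.disc_cross_ne_zero (hQ : IsMinimalSeq ζ Q) {i m : ℕ} (him : i ≤ m)
    (h : ∀ k, i ≤ k → k < m → consecDet Q k = 0)
    (hd : disc (crossProduct (Q i) (Q (i + 1))) ≠ 0) :
    disc (crossProduct (Q i) (Q (m + 1))) ≠ 0 := by
  obtain ⟨r, hr0, hr⟩ := hQ.exists_ratio_cross him h
  set x := crossProduct (Q i) (Q (i + 1)) with hx
  have hi : Q i ⬝ᵥ x = 0 := by simp [hx]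
  have hm : Q (m + 1) ⬝ᵥ x = 0 := by
    have h1 : Q (m + 1) ⬝ᵥ crossProduct (Q m) (Q (m + 1)) = 0 := by simp
    have h2 : ((Q (m + 1) ⬝ᵥ crossProduct (Q m) (Q (m + 1)) : ℤ) : ℝ) =
        r * ((Q (m + 1) ⬝ᵥ x : ℤ) : ℝ) := by
      simp only [Matrix.vec3_dotProduct]; push_cast; rw [hr, hr, hr]; ring
    rw [h1, Int.cast_zero, eq_comm, mul_eq_zero] at h2
    exact_mod_cast h2.resolve_left hr0
  have hcross : crossProduct x (crossProduct (Q i) (Q (m + 1))) = 0 := by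
    simp only [Matrix.vec3_dotProduct] at hi hm
    ext t
    fin_cases t <;> simp [cross_apply (Q i) (Q (m + 1)), cross_apply x]
    · linear_combination Q i 0 * hm - Q (m + 1) 0 * hi
    · linear_combination Q i 1 * hm - Q (m + 1) 1 * hi
    · linear_combination Q i 2 * hm - Q (m + 1) 2 * hi
  obtain ⟨s, hs0, hs⟩ := exists_ratio (hQ.cross_ne_zero i.lt_succ_self)
    (hQ.cross_ne_zero (Nat.lt_succ_of_le him)) hcross
  exact disc_ne_zero_of_ratio hs0 hs hd

end MinimalSeq

section Exponents

variable {ζ : ℝ} {Q : ℕ → Fin 3 → ℤ}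

lemma exists_quadEval_eq_pev (ζ : ℝ) {P : Polynomial ℤ} (hP : P.natDegree ≤ 2) :
    ∃ v : Fin 3 → ℤ, quadEval ζ v = pev ζ P ∧ (quadHeight v : ℝ) ≤ polyH P := by
  refine ⟨fun i => P.coeff i, ?_, Nat.cast_le.2 (quadHeight_le_iff.2 fun i => ?_)⟩
  · rw [pev, aeval_eq_sum_range' (Nat.lt_succ_of_le hP)]
    simp [Finset.sum_range_succ, quadEval]
  · by_cases h : P.coeff i = 0
    · simp [h]
    · exact Finset.le_sup (f := fun i => (P.coeff i).natAbs) (mem_support_iff.2 h)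

lemma IsExtremal.exists_quadEval_le (hζ : IsExtremal ζ) {τ : ℝ} (hτ : τ < goldenRatio + 1) :
    ∀ᶠ X : ℝ in atTop, ∃ v : Fin 3 → ℤ, v ≠ 0 ∧ (quadHeight v : ℝ) ≤ X ∧
      |quadEval ζ v| ≤ X ^ (-τ) := by
  have hw : sSup (whSet 2 ζ) = goldenRatio + 1 := by
    rw [← whExp, hζ.2, goldenRatio]; ring
  have hne : (whSet 2 ζ).Nonempty := by
    by_contra h
    rw [Set.not_nonempty_iff_eq_empty.1 h, Real.sSup_empty] at hw
    linarith [goldenRatio_pos]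
  obtain ⟨τ', ⟨X₀, hX₀⟩, hττ'⟩ := exists_lt_of_lt_csSup hne (hw ▸ hτ)
  filter_upwards [eventually_ge_atTop X₀, eventually_ge_atTop 1] with X hX hX1
  obtain ⟨P, hdeg, hH, hpos, hle⟩ := hX₀ X hX
  obtain ⟨v, hv, hvH⟩ := exists_quadEval_eq_pev ζ hdeg
  refine ⟨v, ?_, hvH.trans hH, ?_⟩
  · rintro rfl
    rw [← hv] at hpos
    simp [quadEval] at hpos
  · rw [hv]
    exact hle.trans (rpow_le_rpow_of_exponent_le hX1 (by linarith))

lemma IsExtremal.exists_isMinimalSeq (hζ : IsExtremal ζ) : ∃ Q, IsMinimalSeq ζ Q := by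
  refine _root_.exists_isMinimalSeq (fun v hv => hζ.1.quadEval_ne_zero hv) fun ε hε => ?_
  have h1 : (1 : ℝ) < goldenRatio + 1 := by linarith [goldenRatio_pos]
  obtain ⟨X, ⟨v, hv, -, hle⟩, hX0, hX⟩ := ((hζ.exists_quadEval_le h1).and
    ((eventually_gt_atTop 0).and (eventually_gt_atTop (1 / ε)))).exists
  refine ⟨v, hv, hle.trans_lt ?_⟩
  rw [rpow_neg_one]
  exact inv_lt_of_inv_lt₀ hε (by rwa [← one_div])

/-- The logarithm of the height of the `n`-th minimal point. -/
noncomputable def logHeight (Q : ℕ → Fin 3 → ℤ) (n : ℕ) : ℝ := log (quadHeight (Q n))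

/-- Minus the logarithm of the absolute value at `ζ` of the `n`-th minimal point. -/
noncomputable def logEval (ζ : ℝ) (Q : ℕ → Fin 3 → ℤ) (n : ℕ) : ℝ := -log |quadEval ζ (Q n)|

lemma IsMinimalSeq.quadHeight_eq (hQ : IsMinimalSeq ζ Q) (n : ℕ) :
    (quadHeight (Q n) : ℝ) = exp (logHeight Q n) :=
  (exp_log (by exact_mod_cast one_le_quadHeight (hQ.ne_zero n))).symm

lemma IsMinimalSeq.quadEval_pos (hQ : IsMinimalSeq ζ Q) (n : ℕ) : 0 < |quadEval ζ (Q n)| :=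
  (abs_nonneg _).trans_lt (hQ.eval_strictAnti n.lt_succ_self)

lemma IsMinimalSeq.quadEval_eq (hQ : IsMinimalSeq ζ Q) (n : ℕ) :
    |quadEval ζ (Q n)| = exp (-logEval ζ Q n) := by
  rw [logEval, neg_neg, exp_log (hQ.quadEval_pos n)]

lemma IsMinimalSeq.logHeight_mono (hQ : IsMinimalSeq ζ Q) : Monotone (logHeight Q) :=
  fun i j hij => log_le_log (by exact_mod_cast one_le_quadHeight (hQ.ne_zero i))
    (by exact_mod_cast hQ.height_strictMono.monotone hij)

lemma IsMinimalSeq.tendsto_logHeight (hQ : IsMinimalSeq ζ Q) :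
    Tendsto (logHeight Q) atTop atTop :=
  tendsto_log_atTop.comp (tendsto_natCast_atTop_atTop.comp hQ.height_strictMono.tendsto_atTop)

lemma IsMinimalSeq.eventually_mul_logHeight_le (hQ : IsMinimalSeq ζ Q) (hζ : IsExtremal ζ) {τ : ℝ}
    (hτ : τ < goldenRatio + 1) : ∀ᶠ n in atTop, τ * logHeight Q (n + 1) ≤ logEval ζ Q n := by
  obtain ⟨τ', hτ', hτ'2⟩ := exists_between hτ
  have hH := hQ.tendsto_logHeight.comp (tendsto_add_atTop_nat 1)
  have hH' : Tendsto (fun n => (quadHeight (Q (n + 1)) : ℝ) / 2) atTop atTop :=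
    (tendsto_natCast_atTop_atTop.comp (hQ.height_strictMono.tendsto_atTop.comp
      (tendsto_add_atTop_nat 1))).atTop_div_const two_pos
  filter_upwards [hH'.eventually (hζ.exists_quadEval_le hτ'2),
    hH.eventually_ge_atTop (τ' * log 2 / (τ' - τ))] with n ⟨v, hv, hvH, hvE⟩ hn
  have hpos : (0 : ℝ) < quadHeight (Q (n + 1)) := by
    exact_mod_cast one_le_quadHeight (hQ.ne_zero (n + 1))
  have hle : |quadEval ζ (Q n)| ≤ |quadEval ζ v| := by
    by_contra! h
    have : (quadHeight (Q (n + 1)) : ℝ) ≤ quadHeight v := by exact_mod_cast hQ.height_le n v hv h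
    linarith
  have hlog := log_le_log (hQ.quadEval_pos n) (hle.trans hvE)
  rw [log_rpow (by positivity), log_div hpos.ne' two_ne_zero] at hlog
  rw [div_le_iff₀ (by linarith)] at hn
  simp only [Function.comp_apply, logHeight, logEval] at hn ⊢
  linarith

lemma errOne_eq_zero (hζ : Transcendental ℚ ζ) {x : Fin 3 → ℤ} (h : errOne ζ x = 0) :
    x 0 = 0 ∧ x 1 = 0 := by
  have : (![x 1, -x 0, 0] : Fin 3 → ℤ) = 0 := by
    by_contra hne
    refine hζ.quadEval_ne_zero hne ?_
    simp only [errOne] at h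
    simp [quadEval]
    linarith
  exact ⟨by simpa using congrFun this 1, by simpa using congrFun this 0⟩

lemma IsMinimalSeq.frequently_consecDet_ne_zero (hQ : IsMinimalSeq ζ Q) (hζ : IsExtremal ζ) :
    ∃ᶠ k in atTop, consecDet Q k ≠ 0 := by
  intro hev
  obtain ⟨N, hN⟩ := eventually_atTop.1 hev
  simp only [not_not] at hN
  set x := crossProduct (Q N) (Q (N + 1)) with hx
  have hlim : Tendsto (fun m => |quadEval ζ (Q m)| * quadHeight (Q (m + 1))) atTop (𝓝 0) := by
    have h2 : (2 : ℝ) < goldenRatio + 1 := by linarith [one_lt_goldenRatio]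
    simp only [hQ.quadEval_eq, hQ.quadHeight_eq, ← exp_add]
    refine tendsto_exp_atBot.comp (tendsto_atBot_mono' _ ?_
      (tendsto_neg_atTop_atBot.comp (hQ.tendsto_logHeight.comp (tendsto_add_atTop_nat 1))))
    filter_upwards [hQ.eventually_mul_logHeight_le hζ h2] with m hm
    simp only [Function.comp_apply]
    linarith
  obtain ⟨c, hc⟩ := Function.ne_iff.1 (hQ.cross_ne_zero N.lt_succ_self)
  have key : ∀ f : (Fin 3 → ℤ) → ℝ,
      (∀ (a b : Fin 3 → ℤ) (r : ℝ), (∀ i, (b i : ℝ) = r * a i) → f b = r * f a) →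
      (∃ A, ∀ m, |f (crossProduct (Q m) (Q (m + 1)))| ≤
        A * (|quadEval ζ (Q m)| * quadHeight (Q (m + 1)))) → f x = 0 := by
    rintro f hf ⟨A, hA⟩
    refine abs_nonpos_iff.1 ((ge_of_tendsto (hlim.const_mul (|(x c : ℝ)| * A)) ?_).trans_eq
      (mul_zero _))
    filter_upwards [eventually_ge_atTop N] with m hm
    obtain ⟨r, hr0, hr⟩ := hQ.exists_ratio_cross hm fun k hk _ => hN k hk
    have hy : crossProduct (Q m) (Q (m + 1)) c ≠ 0 := by
      have : (crossProduct (Q m) (Q (m + 1)) c : ℝ) ≠ 0 := by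
        rw [hr]; exact mul_ne_zero hr0 (by exact_mod_cast hc)
      exact_mod_cast this
    have h1 := one_le_abs_cast hy
    have h2 := hA m
    rw [hr, abs_mul] at h1
    rw [hf _ _ r hr, abs_mul] at h2
    calc |f x| ≤ |r| * |(x c : ℝ)| * |f x| := le_mul_of_one_le_left (abs_nonneg _) h1
      _ = |(x c : ℝ)| * (|r| * |f x|) := by ring
      _ ≤ |(x c : ℝ)| * (A * (|quadEval ζ (Q m)| * quadHeight (Q (m + 1)))) := by gcongr
      _ = _ := by ring
  have hmono : ∀ m, quadHeight (Q m) ≤ quadHeight (Q (m + 1)) :=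
    fun m => (hQ.height_strictMono m.lt_succ_self).le
  have hanti : ∀ m, |quadEval ζ (Q (m + 1))| ≤ |quadEval ζ (Q m)| :=
    fun m => (hQ.eval_strictAnti m.lt_succ_self).le
  have e1 : errOne ζ x = 0 := by
    refine key (errOne ζ) (fun a b r h => by simp only [errOne, h]; ring) ⟨2, fun m => ?_⟩
    exact (abs_errOne_cross_le (hmono m) (hanti m)).trans_eq (by ring)
  have e2 : errTwo ζ x = 0 := by
    refine key (errTwo ζ) (fun a b r h => by simp only [errTwo, h]; ring)
      ⟨2 * evalConst ζ, fun m => ?_⟩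
    exact (abs_errTwo_cross_le (hmono m) (hanti m)).trans_eq (by ring)
  obtain ⟨h0, h1⟩ := errOne_eq_zero hζ.1 e1
  have h2 : x 2 = 0 := by simpa [errTwo, h0, h1] using e2
  refine hQ.cross_ne_zero N.lt_succ_self (funext fun i => ?_)
  fin_cases i <;> assumption

lemma IsMinimalSeq.eventually_disc_ne_zero (hQ : IsMinimalSeq ζ Q) (hζ : IsExtremal ζ) :
    ∀ᶠ k in atTop, consecDet Q k ≠ 0 → disc (crossProduct (Q (k + 1)) (Q (k + 2))) ≠ 0 := by
  have h2 : (5 / 2 : ℝ) < goldenRatio + 1 := by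
    nlinarith [goldenRatio_sq, goldenRatio_pos]
  have hev := hQ.eventually_mul_logHeight_le hζ h2
  have hK := one_le_evalConst ζ
  filter_upwards [hev, (tendsto_add_atTop_nat 1).eventually hev,
    (hQ.tendsto_logHeight.comp (tendsto_add_atTop_nat 1)).eventually_gt_atTop
      (2 * log (8 * evalConst ζ))] with k h1 h2 h3 hdet hd
  simp only [Function.comp_apply] at h3
  have hmono := hQ.logHeight_mono (k + 1).le_succ
  have hle := one_le_of_disc_eq_zero (ζ := ζ) (hQ.ne_zero (k + 1)) (hQ.ne_zero (k + 2))
    (hQ.height_strictMono k.lt_succ_self).le (hQ.height_strictMono (k + 1).lt_succ_self).le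
    (hQ.eval_strictAnti (k + 1).lt_succ_self).le hdet hd
  simp only [hQ.quadEval_eq, hQ.quadHeight_eq, sq, ← exp_add] at hle
  have b1 : exp (logHeight Q (k + 1) + logHeight Q (k + 1) + -logEval ζ Q k) ≤
      exp (-(logHeight Q (k + 1) / 2)) := exp_le_exp.2 (by linarith)
  have b2 : exp (logHeight Q (k + 1) + -logEval ζ Q (k + 1) + logHeight Q (k + 2)) ≤
      exp (-(logHeight Q (k + 1) / 2)) := exp_le_exp.2 (by
        simp only [add_assoc, Nat.reduceAdd, Nat.succ_eq_add_one] at h2 hmono ⊢; linarith)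
  have b3 : 8 * evalConst ζ * exp (-(logHeight Q (k + 1) / 2)) < 1 := by
    rw [← exp_log (show 0 < 8 * evalConst ζ by linarith), ← exp_add, exp_lt_one_iff]
    linarith
  have := mul_le_mul_of_nonneg_left (add_le_add b1 b2) (show 0 ≤ 4 * evalConst ζ by linarith)
  linarith

/-- The indices of the linearly independent triples of consecutive minimal points. -/
structure IsIndexSeq (Q : ℕ → Fin 3 → ℤ) (k : ℕ → ℕ) : Prop where
  strictMono : StrictMono k
  consecDet_ne_zero : ∀ m, consecDet Q (k m) ≠ 0
  disc_ne_zero : ∀ m, disc (crossProduct (Q (k m + 1)) (Q (k m + 2))) ≠ 0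
  consecDet_eq_zero : ∀ m j, k m + 1 ≤ j → j < k (m + 1) → consecDet Q j = 0

lemma IsMinimalSeq.exists_isIndexSeq (hQ : IsMinimalSeq ζ Q) (hζ : IsExtremal ζ) :
    ∃ k, IsIndexSeq Q k := by
  obtain ⟨N, hN⟩ := eventually_atTop.1 (hQ.eventually_disc_ne_zero hζ)
  let p : ℕ → Prop := fun k => N ≤ k ∧ consecDet Q k ≠ 0
  have hp : {k | p k}.Infinite := Nat.frequently_atTop_iff_infinite.1
    ((hQ.frequently_consecDet_ne_zero hζ).and_eventually (eventually_ge_atTop N) |>.mono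
      fun _ h => ⟨h.2, h.1⟩)
  have hmem : ∀ m, p (Nat.nth p m) := Nat.nth_mem_of_infinite hp
  refine ⟨Nat.nth p, Nat.nth_strictMono hp, fun m => (hmem m).2,
    fun m => hN _ (hmem m).1 (hmem m).2, fun m j hj hj' => ?_⟩
  classical
  by_contra h
  have hj2 := Nat.nth_count (p := p) (n := j) ⟨(hmem m).1.trans (by omega), h⟩
  rw [← hj2] at hj hj'
  have h1 := (Nat.nth_strictMono hp).lt_iff_lt.1 (Nat.lt_of_succ_le hj)
  have h2 := (Nat.nth_strictMono hp).lt_iff_lt.1 hj'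
  omega

end Exponents

section GrowthLimits

variable {u v : ℕ → ℝ}

lemma tendsto_ratio_add (hu : Tendsto u atTop atTop)
    (hr : Tendsto (fun k => u (k + 1) / u k) atTop (𝓝 goldenRatio)) (j : ℕ) :
    Tendsto (fun k => u (k + j) / u k) atTop (𝓝 (goldenRatio ^ j)) := by
  induction j with
  | zero =>
    refine tendsto_const_nhds.congr' ?_
    filter_upwards [hu.eventually_gt_atTop 0] with k hk
    simp [hk.ne']
  | succ j ih =>
    rw [pow_succ']
    refine ((hr.comp (tendsto_add_atTop_nat j)).mul ih).congr' ?_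
    filter_upwards [(hu.comp (tendsto_add_atTop_nat j)).eventually_gt_atTop 0] with k hk
    exact div_mul_div_cancel₀ hk.ne'

lemma tendsto_ratio_left_add (hu : Tendsto u atTop atTop)
    (hv : Tendsto (fun k => v k / u k) atTop (𝓝 goldenRatio))
    (hr : Tendsto (fun k => u (k + 1) / u k) atTop (𝓝 goldenRatio)) (j : ℕ) :
    Tendsto (fun k => v (k + j) / u k) atTop (𝓝 (goldenRatio ^ (j + 1))) := by
  rw [pow_succ']
  refine ((hv.comp (tendsto_add_atTop_nat j)).mul (tendsto_ratio_add hu hr j)).congr' ?_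
  filter_upwards [(hu.comp (tendsto_add_atTop_nat j)).eventually_gt_atTop 0] with k hk
  exact div_mul_div_cancel₀ hk.ne'

lemma exists_growth {η : ℝ} (hη : η < 3) (C : ℝ) (hu : Tendsto u atTop atTop)
    (hv : Tendsto (fun k => v k / u k) atTop (𝓝 goldenRatio))
    (hr : Tendsto (fun k => u (k + 1) / u k) atTop (𝓝 goldenRatio)) :
    ∃ ξ > 0, ∃ τ < goldenRatio + 1, ∀ᶠ m in atTop,
      C + u m + v m + u (m + 3) ≤ ξ * u m ∧ C + u (m + 4) ≤ ξ * u m ∧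
      η * (ξ * u m) ≤ τ * v (m + 3) + τ * v m - v m - C ∧
      η * (ξ * u m) ≤ τ * v (m + 4) - C := by
  have hφ := goldenRatio_pos
  have hφ2 := goldenRatio_sq
  have p3 : goldenRatio ^ 3 = 2 * goldenRatio + 1 := by linear_combination (goldenRatio + 1) * hφ2
  have p4 : goldenRatio ^ 4 = 3 * goldenRatio + 2 := by
    linear_combination (goldenRatio ^ 2 + goldenRatio + 2) * hφ2
  have p5 : goldenRatio ^ 5 = 5 * goldenRatio + 3 := by
    linear_combination (goldenRatio ^ 3 + goldenRatio ^ 2 + 2 * goldenRatio + 3) * hφ2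
  have h4 : 0 < goldenRatio ^ 4 := by positivity
  obtain ⟨ξ, hξη, hξ⟩ : ∃ ξ, η * ξ < 3 * goldenRatio ^ 4 ∧ goldenRatio ^ 4 < ξ := by
    have hc : ContinuousAt (fun ξ => η * ξ) (goldenRatio ^ 4) := by fun_prop
    exact (((hc.eventually_lt_const ((mul_lt_mul_iff_left₀ h4).2 hη)).filter_mono
      nhdsWithin_le_nhds).and (self_mem_nhdsWithin (s := Set.Ioi (goldenRatio ^ 4)))).exists
  obtain ⟨τ, ⟨hτ1, hτ2⟩, hτ⟩ : ∃ τ, (η * ξ < τ * goldenRatio ^ 4 + τ * goldenRatio - goldenRatio ∧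
      η * ξ < τ * goldenRatio ^ 5) ∧ τ < goldenRatio + 1 := by
    have hc1 : ContinuousAt (fun τ => τ * goldenRatio ^ 4 + τ * goldenRatio - goldenRatio)
      (goldenRatio + 1) := by fun_prop
    have hc2 : ContinuousAt (fun τ => τ * goldenRatio ^ 5) (goldenRatio + 1) := by fun_prop
    refine (((hc1.eventually_const_lt (hξη.trans_le ?_)).and
      (hc2.eventually_const_lt (hξη.trans_le ?_))).filter_mono
      nhdsWithin_le_nhds |>.and (self_mem_nhdsWithin (s := Set.Iio (goldenRatio + 1)))).exists
    · rw [p4]; nlinarith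
    · rw [p4, p5]; nlinarith
  refine ⟨ξ, h4.trans hξ, τ, hτ, ?_⟩
  have hC : Tendsto (fun m => C / u m) atTop (𝓝 0) := tendsto_const_nhds.div_atTop hu
  have r := tendsto_ratio_add hu hr
  have l := tendsto_ratio_left_add hu hv hr
  have t1 := ((hC.add_const 1).add hv).add (r 3)
  have t2 := hC.add (r 4)
  have t3 := ((((l 3).const_mul τ).add (hv.const_mul τ)).sub hv).sub hC
  have t4 := ((l 4).const_mul τ).sub hC
  filter_upwards [hu.eventually_gt_atTop 0,
    t1.eventually_lt_const (u := ξ) (by rw [p3]; rw [p4] at hξ; linarith),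
    t2.eventually_lt_const (u := ξ) (by linarith),
    t3.eventually_const_lt (u := η * ξ) (by rwa [sub_zero]),
    t4.eventually_const_lt (u := η * ξ) (by rwa [sub_zero])] with m hm m1 m2 m3 m4
  have e : ∀ a, a / u m * u m = a := fun a => div_mul_cancel₀ a hm.ne'
  have m1' := mul_le_mul_of_nonneg_right m1.le hm.le
  have m2' := mul_le_mul_of_nonneg_right m2.le hm.le
  have m3' := mul_le_mul_of_nonneg_right m3.le hm.le
  have m4' := mul_le_mul_of_nonneg_right m4.le hm.le
  simp only [add_mul, sub_mul, mul_assoc, e, one_mul] at m1' m2' m3' m4'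
  exact ⟨by linarith, by linarith, by linarith, by linarith⟩

end GrowthLimits

section IndexSeq

variable {ζ : ℝ} {Q : ℕ → Fin 3 → ℤ} {k : ℕ → ℕ}

lemma IsIndexSeq.tendsto_logHeight (hk : IsIndexSeq Q k) (hQ : IsMinimalSeq ζ Q) (j : ℕ) :
    Tendsto (fun m => logHeight Q (k m + j)) atTop atTop :=
  hQ.tendsto_logHeight.comp ((tendsto_add_atTop_nat j).comp hk.strictMono.tendsto_atTop)

lemma IsIndexSeq.tendsto_ratios (hk : IsIndexSeq Q k) (hQ : IsMinimalSeq ζ Q) (hζ : IsExtremal ζ) :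
    Tendsto (fun m => logHeight Q (k m + 2) / logHeight Q (k m + 1)) atTop (𝓝 goldenRatio) ∧
    Tendsto (fun m => logHeight Q (k (m + 1) + 1) / logHeight Q (k m + 1)) atTop
      (𝓝 goldenRatio) := by
  have hK := one_le_evalConst ζ
  have hK8 : exp (log (8 * evalConst ζ)) = 8 * evalConst ζ := exp_log (by linarith)
  have hmono : ∀ {i j}, i ≤ j → quadHeight (Q i) ≤ quadHeight (Q j) :=
    fun h => hQ.height_strictMono.monotone h
  have hanti : ∀ {i j}, i ≤ j → |quadEval ζ (Q j)| ≤ |quadEval ζ (Q i)| :=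
    fun h => hQ.eval_strictAnti.antitone h
  have hu := hk.tendsto_logHeight hQ 1
  have hev : ∀ {τ}, τ < goldenRatio + 1 → ∀ j, ∀ᶠ m in atTop,
      τ * logHeight Q (k m + j + 1) ≤ logEval ζ Q (k m + j) := fun hτ j =>
    ((tendsto_add_atTop_nat j).comp hk.strictMono.tendsto_atTop).eventually
      (hQ.eventually_mul_logHeight_le hζ hτ)
  have h1 : ∀ τ < goldenRatio + 1, ∀ᶠ m in atTop, τ * logHeight Q (k m + 1) ≤
      log (8 * evalConst ζ) + logHeight Q (k m + 1) + logHeight Q (k m + 2) := by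
    intro τ hτ
    filter_upwards [hev hτ 0] with m hm
    refine hm.trans ?_
    have h := one_le_of_det_ne_zero (ζ := ζ) (hmono (k m).le_succ) (hmono (k m + 1).le_succ)
      (hanti (k m).le_succ) (hanti (k m + 1).le_succ) (hk.consecDet_ne_zero m)
    have h' : 1 ≤ 8 * evalConst ζ * |quadEval ζ (Q (k m))| * quadHeight (Q (k m + 1)) *
        quadHeight (Q (k m + 2)) := h.trans (by gcongr; norm_num)
    rw [← hK8] at h'
    simp only [hQ.quadEval_eq, hQ.quadHeight_eq, ← exp_add, one_le_exp_iff] at h'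
    simp only [add_zero]
    linarith
  have h3 : ∀ τ < goldenRatio + 1, ∀ᶠ m in atTop, τ * logHeight Q (k m + 2) ≤
      log (8 * evalConst ζ) + logHeight Q (k m + 1) + 2 * logHeight Q (k m + 2) := by
    intro τ hτ
    filter_upwards [hev hτ 1] with m hm
    refine hm.trans ?_
    have h := one_le_of_disc_ne_zero (ζ := ζ) (hmono (k m + 1).le_succ) (hanti (k m + 1).le_succ)
      (hmono (k m + 1).le_succ) (hanti (k m + 1).le_succ) one_ne_zero (fun i => (one_mul _).symm)
      (hk.disc_ne_zero m)
    rw [← hK8] at h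
    simp only [hQ.quadEval_eq, hQ.quadHeight_eq, ← exp_add, one_le_exp_iff] at h
    linarith
  have h2 : ∀ τ < goldenRatio + 1, ∀ᶠ m in atTop, τ * logHeight Q (k (m + 1) + 1) ≤
      log (8 * evalConst ζ) + logHeight Q (k m + 1) + logHeight Q (k m + 2) +
        logHeight Q (k (m + 1) + 1) := by
    intro τ hτ
    filter_upwards [(tendsto_add_atTop_nat 1).eventually (hev hτ 0)] with m hm
    refine hm.trans ?_
    obtain ⟨r, hr0, hr⟩ := hQ.exists_ratio_cross (hk.strictMono m.lt_succ_self)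
      (hk.consecDet_eq_zero m)
    have h := one_le_of_disc_ne_zero (ζ := ζ) (hmono (k m + 1).le_succ) (hanti (k m + 1).le_succ)
      (hmono (k (m + 1)).le_succ) (hanti (k (m + 1)).le_succ) hr0 hr (hk.disc_ne_zero m)
    rw [← hK8] at h
    simp only [hQ.quadEval_eq, hQ.quadHeight_eq, ← exp_add, one_le_exp_iff] at h
    simp only [add_zero, Nat.succ_eq_add_one] at h ⊢
    linarith
  have hv := tendsto_ratio_left hu h1 h3
  refine ⟨hv, tendsto_ratio_succ hu (fun m => hQ.logHeight_mono ?_) h2 hv⟩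
  have := hk.strictMono m.lt_succ_self
  simp only [Nat.succ_eq_add_one] at this
  omega

lemma abs_linear_cross_le {p q : Fin 3 → ℤ} (hH : quadHeight p ≤ quadHeight q)
    (hE : |quadEval ζ q| ≤ |quadEval ζ p|) :
    |(crossProduct p q 0 * ζ - crossProduct p q 1 : ℝ)| ≤
      4 * evalConst ζ * (|quadEval ζ p| * quadHeight q) ∧
    |(crossProduct p q 1 * ζ - crossProduct p q 2 : ℝ)| ≤
      4 * evalConst ζ * (|quadEval ζ p| * quadHeight q) := by
  set x := crossProduct p q with hx
  have hK := one_le_evalConst ζ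
  have hζK : |ζ| ≤ evalConst ζ := by
    unfold evalConst; linarith [abs_nonneg ζ, sq_nonneg ζ]
  have h1 := abs_errOne_cross_le hH hE
  have h2 := abs_errTwo_cross_le hH hE
  rw [← hx] at h1 h2
  have h3 : 0 ≤ |quadEval ζ p| * quadHeight q := by positivity
  have h4 := mul_le_mul hζK h1 (abs_nonneg _) (by linarith)
  have e1 : (x 0 * ζ - x 1 : ℝ) = -errOne ζ x := by simp only [errOne]; ring
  have e2 : (x 1 * ζ - x 2 : ℝ) = -(errTwo ζ x + ζ * errOne ζ x) := by
    simp only [errOne, errTwo]; ring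
  rw [e1, e2, abs_neg, abs_neg]
  refine ⟨by nlinarith, (abs_add_le _ _).trans ?_⟩
  rw [abs_mul]
  linarith

end IndexSeq

theorem extremal_w34_lower (ζ : ℝ) (hζ : IsExtremal ζ) :
    ∀ η : ℝ, η < 3 → ∀ X₀ : ℝ, ∃ X : ℝ, X₀ ≤ X ∧
      ∃ P : Fin 4 → Polynomial ℤ, LinearIndependent ℤ P ∧ ∀ i : Fin 4,
        (P i).natDegree ≤ 3 ∧ polyH (P i) ≤ X ∧
        0 < |pev ζ (P i)| ∧ |pev ζ (P i)| ≤ X ^ (-η) := by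
  intro η hη X₀
  obtain ⟨Q, hQ⟩ := hζ.exists_isMinimalSeq
  obtain ⟨k, hk⟩ := hQ.exists_isIndexSeq hζ
  have hK := one_le_evalConst ζ
  have hK4 : exp (log (4 * evalConst ζ)) = 4 * evalConst ζ := exp_log (by linarith)
  have hζK : |ζ| ≤ evalConst ζ := by
    unfold evalConst; linarith [abs_nonneg ζ, sq_nonneg ζ]
  obtain ⟨hv, hr⟩ := hk.tendsto_ratios hQ hζ
  have hu := hk.tendsto_logHeight hQ 1
  obtain ⟨ξ, hξ, τ, hτ, hev⟩ := exists_growth hη (log (4 * evalConst ζ)) hu hv hr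
  have hE : ∀ j, ∀ᶠ m in atTop,
      τ * logHeight Q (k (m + j) + 2) ≤ logEval ζ Q (k (m + j) + 1) := fun j =>
    ((tendsto_add_atTop_nat 1).comp (hk.strictMono.tendsto_atTop.comp
      (tendsto_add_atTop_nat j))).eventually (hQ.eventually_mul_logHeight_le hζ hτ)
  obtain ⟨m, ⟨g1, g2, g3, g4⟩, hX₀, E0, E3, E4⟩ := (hev.and
    (((tendsto_exp_atTop.comp (hu.const_mul_atTop hξ)).eventually_ge_atTop X₀).and
      ((hE 0).and ((hE 3).and (hE 4))))).exists
  simp only [Function.comp_apply, add_zero] at hX₀ E0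
  set x := crossProduct (Q (k m + 1)) (Q (k m + 2)) with hx
  set p := Q (k (m + 3) + 1) with hp
  set q := Q (k (m + 4) + 1) with hq
  have hpq : disc (crossProduct p q) ≠ 0 :=
    hQ.disc_cross_ne_zero (hk.strictMono (m + 3).lt_succ_self) (hk.consecDet_eq_zero (m + 3))
      (hk.disc_ne_zero (m + 3))
  have hind := linearIndependent_products hpq (hk.disc_ne_zero m)
  refine ⟨exp (ξ * logHeight Q (k m + 1)), hX₀, _, hind, fun i =>
    ⟨natDegree_cubicPoly_le _, ?_, abs_pos.2 (hζ.1.pev_ne_zero (hind.ne_zero i)), ?_⟩⟩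
  · have hA : ∀ a b : ℤ, |(a : ℝ)| ≤ 2 * quadHeight (Q (k m + 1)) * quadHeight (Q (k m + 2)) →
        |(b : ℝ)| ≤ 2 * quadHeight (Q (k m + 1)) * quadHeight (Q (k m + 2)) →
        polyH (cubicPoly (mulLinear p a b)) ≤ exp (ξ * logHeight Q (k m + 1)) := by
      intro a b ha hb
      refine (polyH_cubicPoly_le (abs_mulLinear_le ha hb)).trans (le_trans ?_ (exp_le_exp.2 g1))
      simp only [exp_add, hK4, ← hQ.quadHeight_eq]
      have : 0 ≤ (quadHeight (Q (k m + 1)) * quadHeight (Q (k m + 2)) * quadHeight p : ℝ) := by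
        positivity
      nlinarith
    have hB : ∀ a b : ℤ, |(a : ℝ)| ≤ 1 → |(b : ℝ)| ≤ 1 →
        polyH (cubicPoly (mulLinear q a b)) ≤ exp (ξ * logHeight Q (k m + 1)) := by
      intro a b ha hb
      refine (polyH_cubicPoly_le (abs_mulLinear_le ha hb)).trans (le_trans ?_ (exp_le_exp.2 g2))
      simp only [exp_add, hK4, ← hQ.quadHeight_eq]
      gcongr
      linarith
    fin_cases i
    · exact hA _ _ (abs_cross_le _ _ _) (abs_cross_le _ _ _)
    · exact hA _ _ (abs_cross_le _ _ _) (abs_cross_le _ _ _)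
    · exact hB _ _ (by simp) (by simp)
    · exact hB _ _ (by simp) (by simp)
  · rw [← exp_mul]
    have hA : ∀ a b : ℤ, |(b * ζ - a : ℝ)| ≤ 4 * evalConst ζ *
        (|quadEval ζ (Q (k m + 1))| * quadHeight (Q (k m + 2))) →
        |pev ζ (cubicPoly (mulLinear p a b))| ≤ exp (ξ * logHeight Q (k m + 1) * -η) := by
      intro a b hab
      rw [pev_mulLinear, abs_mul]
      refine (mul_le_mul_of_nonneg_left hab (abs_nonneg _)).trans ?_
      rw [← hK4, hp]
      simp only [hQ.quadEval_eq, hQ.quadHeight_eq, ← exp_add]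
      exact exp_le_exp.2 (by linarith)
    have hB : ∀ a b : ℤ, |(b * ζ - a : ℝ)| ≤ 4 * evalConst ζ →
        |pev ζ (cubicPoly (mulLinear q a b))| ≤ exp (ξ * logHeight Q (k m + 1) * -η) := by
      intro a b hab
      rw [pev_mulLinear, abs_mul]
      refine (mul_le_mul_of_nonneg_left hab (abs_nonneg _)).trans ?_
      rw [← hK4, hq]
      simp only [hQ.quadEval_eq, ← exp_add]
      exact exp_le_exp.2 (by linarith)
    have hlin := abs_linear_cross_le (ζ := ζ) (hQ.height_strictMono (k m + 1).lt_succ_self).le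
      (hQ.eval_strictAnti (k m + 1).lt_succ_self).le
    fin_cases i
    · exact hA _ _ hlin.1
    · exact hA _ _ hlin.2
    · exact hB _ _ (by simp; linarith)
    · exact hB _ _ (by simp; linarith)
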